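/- arXiv:1301.6787 — 3 statements merged into one kernel-verified Lean document; each statement's English description precedes it below -/
import Mathlib

section
/- For b > 0, the spectrum allocation game has exactly one pure Nash equilibrium: there exists a unique pair (ω_1*, ω_2*) ∈ [0, ω̄]² such that u_1(ω_1*, ω_2*) ≥ u_1(ω_1, ω_2*) for all ω_1 ∈ [0, ω̄] and u_2(ω_1*, ω_2*) ≥ u_2(ω_1*, ω_2) for all ω_2 ∈ [0, ω̄]. -/
/-- The minimiser of the distance to `c` over `[0, W]` is the clamping of `c`. -/
theorem sq_dist_min_on_Icc_iff {W : ℝ} (hW : 0 ≤ W) (c x : ℝ) :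
    (x ∈ Set.Icc 0 W ∧ ∀ t ∈ Set.Icc 0 W, (x - c) ^ 2 ≤ (t - c) ^ 2) ↔ max 0 (min W c) = x := by
  constructor
  · rintro ⟨⟨hx0, hxW⟩, hx⟩
    rcases le_total c 0 with hc | hc
    · have h := hx 0 ⟨le_rfl, hW⟩
      rw [min_eq_right (hc.trans hW), max_eq_left hc]
      nlinarith
    · rcases le_total c W with hcW | hcW
      · have h := hx c ⟨hc, hcW⟩
        rw [min_eq_right hcW, max_eq_right hc]
        nlinarith
      · have h := hx W ⟨hW, le_rfl⟩
        rw [min_eq_left hcW, max_eq_right hW]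
        nlinarith
  · rintro rfl
    refine ⟨⟨le_max_left _ _, max_le hW (min_le_left _ _)⟩, fun t ht => ?_⟩
    obtain ⟨ht0, htW⟩ := ht
    rcases le_total c 0 with hc | hc
    · rw [min_eq_right (hc.trans hW), max_eq_left hc]
      nlinarith
    · rcases le_total c W with hcW | hcW
      · rw [min_eq_right hcW, max_eq_right hc]
        nlinarith [sq_nonneg (t - c)]
      · rw [min_eq_left hcW, max_eq_right hW]
        nlinarith

/-- A user's utility is a concave quadratic in its own bandwidth, so comparing utilities amounts to
comparing squared distances to the unconstrained maximiser. -/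
theorem utility_le_iff {b : ℝ} (hb : 0 < b) (W φ ψ x t y : ℝ) :
    φ * (W - t) + ψ * t - b * (t + y) * t ≤ φ * (W - x) + ψ * x - b * (x + y) * x ↔
      (x - ((ψ - φ) / (2 * b) - y / 2)) ^ 2 ≤ (t - ((ψ - φ) / (2 * b) - y / 2)) ^ 2 := by
  have key : (φ * (W - x) + ψ * x - b * (x + y) * x) - (φ * (W - t) + ψ * t - b * (t + y) * t) =
      b * ((t - ((ψ - φ) / (2 * b) - y / 2)) ^ 2 - (x - ((ψ - φ) / (2 * b) - y / 2)) ^ 2) := by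
    field_simp
    ring
  rw [← sub_nonneg, key, mul_nonneg_iff_of_pos_left hb, sub_nonneg]

theorem abs_clamp_sub_clamp_le (W c d : ℝ) :
    |max 0 (min W c) - max 0 (min W d)| ≤ |c - d| := by
  calc |max 0 (min W c) - max 0 (min W d)| ≤ |min W c - min W d| := by
        simpa using abs_max_sub_max_le_max 0 (min W c) 0 (min W d)
    _ ≤ |c - d| := by simpa using abs_min_sub_min_le_max W c W d

/-- The joint best response map of the game. -/
noncomputable def bestResponse (W a₁ a₂ : ℝ) (p : ℝ × ℝ) : ℝ × ℝ :=
  (max 0 (min W (a₁ - p.2 / 2)), max 0 (min W (a₂ - p.1 / 2)))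

theorem contractingWith_bestResponse (W a₁ a₂ : ℝ) :
    ContractingWith (1 / 2) (bestResponse W a₁ a₂) := by
  refine ⟨by rw [← NNReal.coe_lt_coe]; norm_num, LipschitzWith.of_dist_le_mul fun p q => ?_⟩
  have half (a x y : ℝ) : |a - x / 2 - (a - y / 2)| = |x - y| / 2 := by
    rw [show a - x / 2 - (a - y / 2) = -((x - y) / 2) by ring, abs_neg, abs_div, abs_two]
  have h₁ := abs_clamp_sub_clamp_le W (a₁ - p.2 / 2) (a₁ - q.2 / 2)
  have h₂ := abs_clamp_sub_clamp_le W (a₂ - p.1 / 2) (a₂ - q.1 / 2)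
  rw [half] at h₁ h₂
  have m₁ := le_max_left |p.1 - q.1| |p.2 - q.2|
  have m₂ := le_max_right |p.1 - q.1| |p.2 - q.2|
  simp only [bestResponse, Prod.dist_eq, Real.dist_eq, NNReal.coe_div, NNReal.coe_one,
    NNReal.coe_ofNat]
  exact max_le (by linarith) (by linarith)

/-- For `b > 0`, the spectrum allocation game has exactly one pure Nash
equilibrium: a unique pair `(ω_1*, ω_2*) ∈ [0, ω̄]²` such that neither user can
increase its own utility by unilaterally deviating within `[0, ω̄]`. -/
theorem unique_pure_nash_equilibrium
    (ωbar b φ1 φ2 ψ1 ψ2 : ℝ)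
    (hωbar : 0 < ωbar) (hb : 0 < b)
    (hφ1 : 0 ≤ φ1) (hφ2 : 0 ≤ φ2) (hψ1 : 0 ≤ ψ1) (hψ2 : 0 ≤ ψ2)
    (u1 u2 : ℝ → ℝ → ℝ)
    (hu1 : ∀ ω1 ω2, u1 ω1 ω2 = φ1 * (ωbar - ω1) + ψ1 * ω1 - b * (ω1 + ω2) * ω1)
    (hu2 : ∀ ω1 ω2, u2 ω1 ω2 = φ2 * (ωbar - ω2) + ψ2 * ω2 - b * (ω1 + ω2) * ω2) :
    ∃! p : ℝ × ℝ,
      p.1 ∈ Set.Icc (0 : ℝ) ωbar ∧ p.2 ∈ Set.Icc (0 : ℝ) ωbar ∧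
      (∀ ω1 ∈ Set.Icc (0 : ℝ) ωbar, u1 ω1 p.2 ≤ u1 p.1 p.2) ∧
      (∀ ω2 ∈ Set.Icc (0 : ℝ) ωbar, u2 p.1 ω2 ≤ u2 p.1 p.2) := by
  have nash_iff (p : ℝ × ℝ) : (p.1 ∈ Set.Icc (0 : ℝ) ωbar ∧ p.2 ∈ Set.Icc (0 : ℝ) ωbar ∧
      (∀ ω1 ∈ Set.Icc (0 : ℝ) ωbar, u1 ω1 p.2 ≤ u1 p.1 p.2) ∧
      (∀ ω2 ∈ Set.Icc (0 : ℝ) ωbar, u2 p.1 ω2 ≤ u2 p.1 p.2)) ↔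
      bestResponse ωbar ((ψ1 - φ1) / (2 * b)) ((ψ2 - φ2) / (2 * b)) p = p := by
    have hu2' (x y : ℝ) : u2 x y = φ2 * (ωbar - y) + ψ2 * y - b * (y + x) * y := by
      rw [hu2, add_comm x]
    simp only [hu1, hu2', utility_le_iff hb]
    rw [bestResponse, Prod.ext_iff, ← sq_dist_min_on_Icc_iff hωbar.le,
      ← sq_dist_min_on_Icc_iff hωbar.le]
    tauto
  have hT := contractingWith_bestResponse ωbar ((ψ1 - φ1) / (2 * b)) ((ψ2 - φ2) / (2 * b))
  simp only [nash_iff]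
  exact ⟨_, hT.fixedPoint_isFixedPt, fun _ hq => hT.fixedPoint_unique hq⟩
end

section
/- Since the achievable utility region R is a nonempty connected subset of the plane ℝ², time-sharing between just two operating points already yields its full convex hull: R̄ = {μ a + (1−μ) a' : μ ∈ [0,1], a, a' ∈ R} equals convexHull(R). -/
/-- The planar determinant of `p - x` and `q - x`. -/
def crossAt (x p q : ℝ × ℝ) : ℝ :=
  (p.1 - x.1) * (q.2 - x.2) - (p.2 - x.2) * (q.1 - x.1)

theorem mem_segment_of_balanced {x p q : ℝ × ℝ} {s t : ℝ} (hs : 0 ≤ s) (ht : 0 ≤ t)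
    (hst : 0 < s + t) (h1 : s * (p.1 - x.1) + t * (q.1 - x.1) = 0)
    (h2 : s * (p.2 - x.2) + t * (q.2 - x.2) = 0) : x ∈ segment ℝ p q := by
  refine ⟨s / (s + t), t / (s + t), by positivity, by positivity, by field_simp, ?_⟩
  ext
  · simp only [Prod.fst_add, Prod.smul_fst, smul_eq_mul]
    field_simp
    linarith
  · simp only [Prod.snd_add, Prod.smul_snd, smul_eq_mul]
    field_simp
    linarith

theorem mem_segment_of_crossAt_eq_zero {x a b c : ℝ × ℝ} {α β γ : ℝ} (hα : 0 < α) (hβ : 0 < β)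
    (hγ : 0 < γ) (h1 : α * (a.1 - x.1) + β * (b.1 - x.1) + γ * (c.1 - x.1) = 0)
    (h2 : α * (a.2 - x.2) + β * (b.2 - x.2) + γ * (c.2 - x.2) = 0)
    (hbc : crossAt x b c = 0) : x ∈ segment ℝ b c ∨ x ∈ segment ℝ a b := by
  unfold crossAt at hbc
  by_cases hb : (b.1 - x.1) ^ 2 + (b.2 - x.2) ^ 2 = 0
  · have hb1 : b.1 - x.1 = 0 := by nlinarith [sq_nonneg (b.1 - x.1), sq_nonneg (b.2 - x.2)]
    have hb2 : b.2 - x.2 = 0 := by nlinarith [sq_nonneg (b.1 - x.1), sq_nonneg (b.2 - x.2)]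
    exact .inl (mem_segment_of_balanced (s := 1) (t := 0) one_pos.le le_rfl (by norm_num)
      (by simp [hb1]) (by simp [hb2]))
  have hN : 0 < (b.1 - x.1) ^ 2 + (b.2 - x.2) ^ 2 := lt_of_le_of_ne (by positivity) (Ne.symm hb)
  set N := (b.1 - x.1) ^ 2 + (b.2 - x.2) ^ 2 with hNdef
  set M := (b.1 - x.1) * (c.1 - x.1) + (b.2 - x.2) * (c.2 - x.2) with hMdef
  have e1 : N * (c.1 - x.1) = M * (b.1 - x.1) := by
    rw [hNdef, hMdef]; linear_combination (-(b.2 - x.2)) * hbc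
  have e2 : N * (c.2 - x.2) = M * (b.2 - x.2) := by
    rw [hNdef, hMdef]; linear_combination (b.1 - x.1) * hbc
  rcases le_total M 0 with hM | hM
  · exact .inl (mem_segment_of_balanced (s := -M) (t := N) (by linarith) hN.le (by linarith)
      (by linarith) (by linarith))
  · exact .inr (mem_segment_of_balanced (s := N * α) (t := N * β + γ * M) (by positivity)
      (by positivity) (by positivity) (by linear_combination N * h1 - γ * e1)
      (by linear_combination N * h2 - γ * e2))

theorem IsPreconnected.exists_mem_segment_of_crossAt_pos {S : Set (ℝ × ℝ)} (hS : IsPreconnected S)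
    {x a b c : ℝ × ℝ} (ha : a ∈ S) (hb : b ∈ S) (hc : c ∈ S) {α β γ : ℝ} (hα : 0 < α) (hβ : 0 < β)
    (hγ : 0 < γ) (h1 : α * (a.1 - x.1) + β * (b.1 - x.1) + γ * (c.1 - x.1) = 0)
    (h2 : α * (a.2 - x.2) + β * (b.2 - x.2) + γ * (c.2 - x.2) = 0)
    (hbc : 0 < crossAt x b c) : ∃ p ∈ S, ∃ q ∈ S, x ∈ segment ℝ p q := by
  by_contra hcon
  have hcont : ∀ q, Continuous fun p => crossAt x p q := fun q => by unfold crossAt; fun_prop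
  have hU : IsOpen {p | crossAt x p c < 0 ∧ 0 < crossAt x p b} :=
    (isOpen_lt (hcont c) continuous_const).inter (isOpen_lt continuous_const (hcont b))
  have hV : IsOpen {p | 0 < crossAt x p c ∨ crossAt x p b < 0} :=
    (isOpen_lt continuous_const (hcont c)).union (isOpen_lt (hcont b) continuous_const)
  have hcover : S ⊆ {p | crossAt x p c < 0 ∧ 0 < crossAt x p b} ∪
      {p | 0 < crossAt x p c ∨ crossAt x p b < 0} := by
    intro p hp
    by_contra hpUV
    simp only [Set.mem_union, Set.mem_ofPred_eq, not_or, not_and, not_lt] at hpUV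
    obtain ⟨hpU, hpc, hpb⟩ := hpUV
    rcases hpc.lt_or_eq with hlt | heq
    · have hpb0 : crossAt x p b = 0 := le_antisymm (hpU hlt) hpb
      refine hcon ⟨p, hp, b, hb, mem_segment_of_balanced (s := crossAt x b c)
        (t := -crossAt x p c) hbc.le (by linarith) (by linarith) ?_ ?_⟩
      · unfold crossAt at *; linear_combination (-(c.1 - x.1)) * hpb0
      · unfold crossAt at *; linear_combination (-(c.2 - x.2)) * hpb0
    · refine hcon ⟨p, hp, c, hc, mem_segment_of_balanced (s := crossAt x b c)
        (t := crossAt x p b) hbc.le hpb (by linarith) ?_ ?_⟩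
      · unfold crossAt at *; linear_combination (b.1 - x.1) * heq
      · unfold crossAt at *; linear_combination (b.2 - x.2) * heq
  have hac : α * crossAt x a c = -(β * crossAt x b c) := by
    unfold crossAt; linear_combination (c.2 - x.2) * h1 - (c.1 - x.1) * h2
  have hab : α * crossAt x a b = γ * crossAt x b c := by
    unfold crossAt; linear_combination (b.2 - x.2) * h1 - (b.1 - x.1) * h2
  have hβbc := mul_pos hβ hbc
  have hγbc := mul_pos hγ hbc
  have haU : crossAt x a c < 0 ∧ 0 < crossAt x a b :=
    ⟨by by_contra! h; nlinarith [mul_nonneg hα.le h],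
      pos_of_mul_pos_right (hab ▸ hγbc) hα.le⟩
  obtain ⟨p, -, ⟨hp1, hp2⟩, hp3⟩ := hS _ _ hU hV hcover ⟨a, ha, haU⟩ ⟨b, hb, .inl hbc⟩
  rcases hp3 with h | h <;> linarith

theorem IsPreconnected.exists_mem_segment_of_triangle {S : Set (ℝ × ℝ)} (hS : IsPreconnected S)
    {x a b c : ℝ × ℝ} (ha : a ∈ S) (hb : b ∈ S) (hc : c ∈ S) {α β γ : ℝ} (hα : 0 < α) (hβ : 0 < β)
    (hγ : 0 < γ) (hsum : α + β + γ = 1) (hx : α • a + β • b + γ • c = x) :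
    ∃ p ∈ S, ∃ q ∈ S, x ∈ segment ℝ p q := by
  have h1 : α * (a.1 - x.1) + β * (b.1 - x.1) + γ * (c.1 - x.1) = 0 := by
    have := congrArg Prod.fst hx
    simp only [Prod.fst_add, Prod.smul_fst, smul_eq_mul] at this
    linear_combination this - x.1 * hsum
  have h2 : α * (a.2 - x.2) + β * (b.2 - x.2) + γ * (c.2 - x.2) = 0 := by
    have := congrArg Prod.snd hx
    simp only [Prod.snd_add, Prod.smul_snd, smul_eq_mul] at this
    linear_combination this - x.2 * hsum
  rcases lt_trichotomy (crossAt x b c) 0 with h | h | h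
  · refine hS.exists_mem_segment_of_crossAt_pos ha hc hb hα hγ hβ (by linarith) (by linarith) ?_
    unfold crossAt at *; linarith
  · rcases mem_segment_of_crossAt_eq_zero hα hβ hγ h1 h2 h with h | h
    · exact ⟨b, hb, c, hc, h⟩
    · exact ⟨a, ha, b, hb, h⟩
  · exact hS.exists_mem_segment_of_crossAt_pos ha hb hc hα hβ hγ h1 h2 h

/-- **Fenchel–Bunt theorem in the plane**: every point of the convex hull of a connected planar
set lies on a segment between two points of the set. -/
theorem IsPreconnected.exists_mem_segment_of_mem_convexHull {S : Set (ℝ × ℝ)}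
    (hS : IsPreconnected S) {x : ℝ × ℝ} (hx : x ∈ convexHull ℝ S) :
    ∃ p ∈ S, ∃ q ∈ S, x ∈ segment ℝ p q := by
  obtain ⟨ι, _, z, w, hz, hind, hw, hsum, hxz⟩ := eq_pos_convex_span_of_mem_convexHull hx
  have hzS : ∀ i, z i ∈ S := fun i => hz ⟨i, rfl⟩
  have hcard : Fintype.card ι ≤ 3 := by
    have h := hind.card_le_finrank_succ
    have h' := Submodule.finrank_le (vectorSpan ℝ (Set.range z))
    simp only [Module.finrank_prod, Module.finrank_self] at h'
    omega
  obtain ⟨n, hn⟩ : ∃ n, Fintype.card ι = n := ⟨_, rfl⟩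
  let e := (Fintype.equivFinOfCardEq hn).symm
  rw [← e.sum_comp] at hsum hxz
  have hn3 : n ≤ 3 := hn ▸ hcard
  clear_value e
  interval_cases n
  · simp at hsum
  · simp only [Fin.sum_univ_one] at hsum hxz
    rw [hsum, one_smul] at hxz
    exact ⟨_, hzS (e 0), _, hzS (e 0), by rw [hxz]; exact left_mem_segment ℝ x x⟩
  · rw [Fin.sum_univ_two] at hsum hxz
    exact ⟨_, hzS (e 0), _, hzS (e 1), _, _, (hw _).le, (hw _).le, hsum, hxz⟩
  · rw [Fin.sum_univ_three] at hsum hxz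
    exact hS.exists_mem_segment_of_triangle (hzS _) (hzS _) (hzS _) (hw _) (hw _) (hw _) hsum hxz

/-- Since the achievable utility region `R` is a nonempty connected
subset of the plane `ℝ²`, time-sharing between just two operating points already
yields its full convex hull: `R̄ = {μ a + (1−μ) a' : μ ∈ [0,1], a, a' ∈ R}` equals
`convexHull ℝ R`. -/
theorem time_sharing_region_eq_convex_hull
    (ωbar b φ1 φ2 ψ1 ψ2 : ℝ)
    (hωbar : 0 < ωbar) (hb : 0 < b)
    (hφ1 : 0 ≤ φ1) (hφ2 : 0 ≤ φ2) (hψ1 : 0 ≤ ψ1) (hψ2 : 0 ≤ ψ2)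
    (u1 u2 : ℝ → ℝ → ℝ)
    (hu1 : ∀ ω1 ω2, u1 ω1 ω2 = φ1 * (ωbar - ω1) + ψ1 * ω1 - b * (ω1 + ω2) * ω1)
    (hu2 : ∀ ω1 ω2, u2 ω1 ω2 = φ2 * (ωbar - ω2) + ψ2 * ω2 - b * (ω1 + ω2) * ω2)
    (R Rbar : Set (ℝ × ℝ))
    (hR : R = (fun p : ℝ × ℝ => (u1 p.1 p.2, u2 p.1 p.2)) ''
      (Set.Icc (0 : ℝ) ωbar ×ˢ Set.Icc (0 : ℝ) ωbar))
    (hRbar : Rbar = {x : ℝ × ℝ | ∃ μ ∈ Set.Icc (0 : ℝ) 1, ∃ a ∈ R, ∃ a' ∈ R,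
      x = μ • a + (1 - μ) • a'}) :
    Rbar = convexHull ℝ R := by
  have hconn : IsPreconnected R := by
    rw [hR]
    simp only [hu1, hu2]
    exact (isPreconnected_Icc.prod isPreconnected_Icc).image _ (by fun_prop)
  rw [hRbar]
  apply Set.Subset.antisymm
  · rintro x ⟨μ, hμ, a, ha, a', ha', rfl⟩
    exact convex_convexHull ℝ R (subset_convexHull ℝ R ha) (subset_convexHull ℝ R ha')
      hμ.1 (sub_nonneg.2 hμ.2) (by ring)
  · intro x hx
    obtain ⟨p, hp, q, hq, s, t, hs, ht, hst, hxpq⟩ := hconn.exists_mem_segment_of_mem_convexHull hx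
    refine ⟨s, ⟨hs, by linarith⟩, p, hp, q, hq, ?_⟩
    rw [← hxpq, ← hst, add_sub_cancel_left]
end

section
/- Uniqueness of the Nash bargaining solution: let S ⊆ ℝ² be a convex set, d = (d_1, d_2) ∈ ℝ², and S⁺ = {(v_1, v_2) ∈ S : v_1 ≥ d_1, v_2 ≥ d_2}. Assume there exists w ∈ S with w_1 > d_1 and w_2 > d_2. If u and v both maximize the Nash product π(v_1, v_2) = (v_1 − d_1)(v_2 − d_2) over S⁺, then u = v. -/
theorem eq_and_eq_of_mul_eq_of_add_mul_add_le {a b c e : ℝ} (ha : 0 ≤ a) (hb : 0 ≤ b)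
    (hc : 0 ≤ c) (hpos : 0 < a * b) (hprod : a * b = c * e)
    (hle : (a + c) * (b + e) ≤ 4 * (a * b)) : a = c ∧ b = e := by
  have ha' : 0 < a := pos_of_mul_pos_left hpos hb
  have hb' : 0 < b := pos_of_mul_pos_right hpos ha
  have hac : a = c := by
    rcases lt_trichotomy a c with h | h | h
    · have hbe : e < b := by nlinarith
      nlinarith [mul_pos (sub_pos.2 h) (sub_pos.2 hbe)]
    · exact h
    · have hbe : b < e := by nlinarith
      nlinarith [mul_pos (sub_pos.2 h) (sub_pos.2 hbe)]
  subst hac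
  exact ⟨rfl, mul_left_cancel₀ ha'.ne' hprod⟩

/-- Uniqueness of the Nash bargaining solution. Let `S ⊆ ℝ²` be convex,
`d ∈ ℝ²`, and `S⁺ = {v ∈ S : v_1 ≥ d_1, v_2 ≥ d_2}`. If there is `w ∈ S` with
`w_1 > d_1` and `w_2 > d_2`, and `u, v` both maximize the Nash product
`(v_1 − d_1)(v_2 − d_2)` over `S⁺`, then `u = v`. -/
theorem nash_bargaining_solution_unique
    (S : Set (ℝ × ℝ)) (hS : Convex ℝ S)
    (d : ℝ × ℝ)
    (Splus : Set (ℝ × ℝ))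
    (hSplus : Splus = {v : ℝ × ℝ | v ∈ S ∧ d.1 ≤ v.1 ∧ d.2 ≤ v.2})
    (w : ℝ × ℝ) (hw : w ∈ S) (hw1 : d.1 < w.1) (hw2 : d.2 < w.2)
    (u v : ℝ × ℝ) (hu : u ∈ Splus) (hv : v ∈ Splus)
    (hmaxu : ∀ x ∈ Splus, (x.1 - d.1) * (x.2 - d.2) ≤ (u.1 - d.1) * (u.2 - d.2))
    (hmaxv : ∀ x ∈ Splus, (x.1 - d.1) * (x.2 - d.2) ≤ (v.1 - d.1) * (v.2 - d.2)) :
    u = v := by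
  subst hSplus
  obtain ⟨huS, hu1, hu2⟩ := hu
  obtain ⟨hvS, hv1, hv2⟩ := hv
  have hprod : (u.1 - d.1) * (u.2 - d.2) = (v.1 - d.1) * (v.2 - d.2) :=
    le_antisymm (hmaxv u ⟨huS, hu1, hu2⟩) (hmaxu v ⟨hvS, hv1, hv2⟩)
  have hpos : 0 < (u.1 - d.1) * (u.2 - d.2) :=
    (mul_pos (sub_pos.2 hw1) (sub_pos.2 hw2)).trans_le (hmaxu w ⟨hw, hw1.le, hw2.le⟩)
  have hmidS : (1 / 2 : ℝ) • u + (1 / 2 : ℝ) • v ∈ S :=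
    hS huS hvS (by norm_num) (by norm_num) (by norm_num)
  have hmid := hmaxu _ ⟨hmidS,
    by simp only [Prod.fst_add, Prod.smul_fst, smul_eq_mul]; linarith,
    by simp only [Prod.snd_add, Prod.smul_snd, smul_eq_mul]; linarith⟩
  simp only [Prod.fst_add, Prod.snd_add, Prod.smul_fst, Prod.smul_snd, smul_eq_mul] at hmid
  have h := eq_and_eq_of_mul_eq_of_add_mul_add_le (sub_nonneg.2 hu1) (sub_nonneg.2 hu2)
    (sub_nonneg.2 hv1) hpos hprod (by linarith)
  exact Prod.ext (sub_left_injective h.1) (sub_left_injective h.2)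
end
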